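/- For an odd prime p, an integer r ≥ 1, and δ ∈ ℤ/p^rℤ with p ∤ δ a quadratic non-residue mod p, the number of triples (A,B,C) ∈ (ℤ/p^rℤ)³ with p ∤ gcd(A,B,C) and B² − 4AC ≡ δ (mod p^r) equals p^{2r−1}(p−1). -/

import Mathlib

theorem stmt_3 (p r : ℕ) (hp : p.Prime) (hodd : Odd p) (hr : 1 ≤ r)
    (δ : ZMod (p ^ r)) (hδ : ¬ (p : ZMod (p ^ r)) ∣ δ)
    (hQNR : ¬ IsSquare (ZMod.castHom (dvd_pow_self p (Nat.one_le_iff_ne_zero.mp hr)) (ZMod p) δ)) :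
    Nat.card {x : ZMod (p ^ r) × ZMod (p ^ r) × ZMod (p ^ r) //
        ¬ ((p : ZMod (p ^ r)) ∣ x.1 ∧ (p : ZMod (p ^ r)) ∣ x.2.1 ∧ (p : ZMod (p ^ r)) ∣ x.2.2)
        ∧ x.2.1 ^ 2 - 4 * x.1 * x.2.2 = δ}
      = p ^ (2 * r - 1) * (p - 1) := by
  haveI : Fact p.Prime := ⟨hp⟩
  haveI : NeZero (p ^ r) := ⟨pow_ne_zero _ hp.ne_zero⟩
  set φ := ZMod.castHom (dvd_pow_self p (Nat.one_le_iff_ne_zero.mp hr)) (ZMod p) with hφ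
  have hφp : φ (p : ZMod (p ^ r)) = 0 := by simp
  have h4 : IsUnit (4 : ZMod (p ^ r)) := by
    have h : IsUnit ((4 : ℕ) : ZMod (p ^ r)) := by
      rw [ZMod.isUnit_iff_coprime]
      have h2 : Nat.Coprime 2 p := Nat.coprime_two_left.mpr hodd
      exact Nat.Coprime.pow_right r (Nat.Coprime.pow_left 2 h2)
    exact_mod_cast h
  have hnd : ∀ a : ZMod (p ^ r), IsUnit a → ¬ (p : ZMod (p ^ r)) ∣ a := by
    rintro a ha ⟨k, rfl⟩
    have := ha.map φ
    rw [map_mul, hφp, zero_mul] at this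
    exact not_isUnit_zero this
  have hun : ∀ a : ZMod (p ^ r), ¬ (p : ZMod (p ^ r)) ∣ a → IsUnit a := by
    intro a ha
    rw [← ZMod.natCast_zmod_val a, ZMod.isUnit_iff_coprime]
    apply Nat.Coprime.pow_right
    rw [Nat.coprime_comm, hp.coprime_iff_not_dvd]
    rintro ⟨k, hk⟩
    apply ha
    rw [← ZMod.natCast_zmod_val a, hk]
    exact ⟨k, by push_cast; rfl⟩
  obtain ⟨w, hw⟩ := h4
  have hkey : ∀ (u : (ZMod (p ^ r))ˣ) (B : ZMod (p ^ r)),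
      B ^ 2 - 4 * (u : ZMod (p ^ r)) * ((B ^ 2 - δ) * ((w * u)⁻¹ : (ZMod (p ^ r))ˣ)) = δ := by
    intro u B
    have := Units.mul_inv (w * u)
    rw [Units.val_mul, hw] at this
    linear_combination (δ - B ^ 2) * this
  let f : (ZMod (p ^ r))ˣ × ZMod (p ^ r) →
      {x : ZMod (p ^ r) × ZMod (p ^ r) × ZMod (p ^ r) //
        ¬ ((p : ZMod (p ^ r)) ∣ x.1 ∧ (p : ZMod (p ^ r)) ∣ x.2.1 ∧ (p : ZMod (p ^ r)) ∣ x.2.2)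
        ∧ x.2.1 ^ 2 - 4 * x.1 * x.2.2 = δ} := fun y =>
    ⟨(y.1, y.2, (y.2 ^ 2 - δ) * ((w * y.1)⁻¹ : (ZMod (p ^ r))ˣ)),
      fun h => hnd _ y.1.isUnit h.1, hkey y.1 y.2⟩
  have hf : Function.Bijective f := by
    constructor
    · rintro ⟨u, B⟩ ⟨u', B'⟩ h
      have h' := congrArg Subtype.val h
      simp only [f, Prod.mk.injEq] at h'
      exact Prod.ext (Units.ext h'.1) h'.2.1
    · rintro ⟨⟨A, B, C⟩, h1, h2⟩
      simp only at h1 h2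
      have hA : ¬ (p : ZMod (p ^ r)) ∣ A := by
        rintro ⟨k, rfl⟩
        apply hQNR
        refine ⟨φ B, ?_⟩
        rw [← h2]
        simp only [map_sub, map_mul, map_pow, hφp]
        ring
      obtain ⟨u, rfl⟩ := hun A hA
      refine ⟨(u, B), Subtype.ext ?_⟩
      simp only [f, Prod.mk.injEq, true_and]
      have := Units.mul_inv (w * u)
      rw [Units.val_mul, hw] at this
      rw [← h2]
      linear_combination C * this
  rw [← Nat.card_congr (Equiv.ofBijective f hf), Nat.card_prod, Nat.card_eq_fintype_card,
    ZMod.card_units_eq_totient, Nat.card_zmod, Nat.totient_prime_pow hp hr]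
  have : 2 * r - 1 = (r - 1) + r := by omega
  rw [this, pow_add]
  ring
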